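/- Let s ≤ k ≤ n be positive integers. The quotient ring R_{n,k,s} = ℚ[x_1, …, x_n]/I_{n,k,s} is a finite-dimensional ℚ-vector space whose dimension equals the number of functions f : {1, …, n} → {1, …, k} whose image contains {1, …, s}. -/

import Mathlib

open MvPolynomial

/-- The ideal `I_{n,k,s} ⊆ ℚ[x_1, …, x_n]` generated by `x_1^k, …, x_n^k` together with
the elementary symmetric polynomials `e_d(x_1, …, x_n)` for `n−s+1 ≤ d ≤ n`. -/
noncomputable def Inks (n k s : ℕ) : Ideal (MvPolynomial (Fin n) ℚ) :=
  Ideal.span ({p | ∃ i : Fin n, p = X i ^ k} ∪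
    {p | ∃ d : ℕ, n - s + 1 ≤ d ∧ d ≤ n ∧ p = esymm (Fin n) ℚ d})

/-- The ideal generated by `x_i ^ k` and all `e_d` with `n < d + s`. It agrees with `Inks n k s`
when `s ≤ n`, and is the unit ideal when `n < s`. -/
noncomputable def powEsymmIdeal (n k s : ℕ) : Ideal (MvPolynomial (Fin n) ℚ) :=
  Ideal.span ({p | ∃ i : Fin n, p = X i ^ k} ∪
    {p | ∃ d : ℕ, n < d + s ∧ p = esymm (Fin n) ℚ d})

theorem esymm_fin_eq_zero {n d : ℕ} (h : n < d) : esymm (Fin n) ℚ d = 0 := by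
  rw [esymm, Finset.powersetCard_eq_empty.2 (by simpa using h), Finset.sum_empty]

theorem Inks_eq_powEsymmIdeal {n k s : ℕ} (h : s ≤ n) : Inks n k s = powEsymmIdeal n k s := by
  apply le_antisymm
  · refine Ideal.span_mono (Set.union_subset_union_right _ ?_)
    rintro p ⟨d, h1, -, rfl⟩
    exact ⟨d, by omega, rfl⟩
  · refine Ideal.span_le.2 ?_
    rintro p (⟨i, rfl⟩ | ⟨d, hd, rfl⟩)
    · exact Ideal.subset_span (Or.inl ⟨i, rfl⟩)
    · by_cases hdn : d ≤ n
      · exact Ideal.subset_span (Or.inr ⟨d, by omega, hdn, rfl⟩)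
      · rw [esymm_fin_eq_zero (by omega)]
        exact zero_mem _

theorem esymm_fin_succ (n d : ℕ) :
    esymm (Fin (n + 1)) ℚ (d + 1) =
      rename Fin.succ (esymm (Fin n) ℚ (d + 1)) + X 0 * rename Fin.succ (esymm (Fin n) ℚ d) := by
  have hr : ∀ e, rename Fin.succ (esymm (Fin n) ℚ e) =
      ((Finset.univ : Finset (Fin n)).val.map
        fun i => (X i.succ : MvPolynomial (Fin (n + 1)) ℚ)).esymm e := by
    intro e
    rw [← aeval_esymm_eq_multiset_esymm (Fin n) ℚ]
    exact DFunLike.congr_fun (algHom_ext (fun i => by simp) :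
      rename Fin.succ = aeval (R := ℚ) fun i : Fin n => X i.succ) _
  rw [hr, hr, esymm_eq_multiset_esymm, Fin.univ_succ, Finset.cons_val, Multiset.map_cons]
  simp only [Multiset.esymm, Multiset.powersetCard_cons, Multiset.map_add, Multiset.sum_add,
    Multiset.map_map, Function.comp_def, Multiset.prod_cons, Multiset.sum_map_mul_left,
    Finset.map_val]
  rfl

theorem esymm_mem_powEsymmIdeal {n k s d : ℕ} (h : n < d + s) :
    esymm (Fin n) ℚ d ∈ powEsymmIdeal n k s :=
  Ideal.subset_span (Or.inr ⟨d, h, rfl⟩)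

theorem X_pow_mul_rename_esymm_mem {n k s : ℕ} (j : ℕ) :
    ∀ d, n < d + j → n < d + s →
      X 0 ^ j * rename Fin.succ (esymm (Fin n) ℚ d) ∈ powEsymmIdeal (n + 1) k s := by
  induction j with
  | zero =>
    intro d h _
    rw [esymm_fin_eq_zero (by omega), map_zero, mul_zero]
    exact zero_mem _
  | succ j ih =>
    intro d h hs
    have h1 : esymm (Fin (n + 1)) ℚ (d + 1) ∈ powEsymmIdeal (n + 1) k s :=
      esymm_mem_powEsymmIdeal (by omega)
    have h2 := ih (d + 1) (by omega) (by omega)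
    have h3 : X 0 ^ (j + 1) * rename Fin.succ (esymm (Fin n) ℚ d) =
        X 0 ^ j * esymm (Fin (n + 1)) ℚ (d + 1) -
          X 0 ^ j * rename Fin.succ (esymm (Fin n) ℚ (d + 1)) := by
      rw [esymm_fin_succ]; ring
    rw [h3]
    exact sub_mem (Ideal.mul_mem_left _ _ h1) h2

theorem exists_rename_succ_add_X_mul {n : ℕ} (p : MvPolynomial (Fin (n + 1)) ℚ) :
    ∃ q r, p = rename Fin.succ q + X 0 * r := by
  induction p using MvPolynomial.induction_on with
  | C a => exact ⟨C a, 0, by simp⟩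
  | add p p' h h' =>
    obtain ⟨q, r, rfl⟩ := h
    obtain ⟨q', r', rfl⟩ := h'
    exact ⟨q + q', r + r', by rw [map_add]; ring⟩
  | mul_X p i h =>
    obtain ⟨q, r, rfl⟩ := h
    refine Fin.cases ?_ (fun i => ?_) i
    · exact ⟨0, rename Fin.succ q + X 0 * r, by rw [map_zero]; ring⟩
    · exact ⟨q * X i, r * X i.succ, by rw [map_mul, rename_X]; ring⟩

/-- Multiplying by `x_0 ^ i` carries the ideal in the last `n` variables into the ideal in `n + 1`
variables, up to a multiple of `x_0 ^ (i + 1)`. -/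
theorem X_pow_mul_rename_mem {n k s i : ℕ} {q : MvPolynomial (Fin n) ℚ}
    (hq : q ∈ powEsymmIdeal n k (if i < s then s - 1 else s)) :
    X 0 ^ i * rename Fin.succ q ∈ powEsymmIdeal (n + 1) k s ⊔ Ideal.span {X 0 ^ (i + 1)} := by
  unfold powEsymmIdeal at hq
  induction hq using Submodule.span_induction with
  | zero => simp
  | add x y _ _ hx hy =>
    rw [map_add, mul_add]
    exact add_mem hx hy
  | smul a x _ hx =>
    rw [smul_eq_mul, map_mul, mul_left_comm]
    exact Ideal.mul_mem_left _ _ hx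
  | mem x hx =>
    rcases hx with ⟨j, rfl⟩ | ⟨d, hd, rfl⟩
    · rw [map_pow, rename_X]
      exact Ideal.mul_mem_left _ _
        (Ideal.mem_sup_left (Ideal.subset_span (Or.inl ⟨j.succ, rfl⟩)))
    · by_cases h : n + 1 < d + s
      · cases d with
        | zero =>
          have h1 : esymm (Fin (n + 1)) ℚ 0 ∈ powEsymmIdeal (n + 1) k s :=
            esymm_mem_powEsymmIdeal (by omega)
          rw [esymm_zero] at h1 ⊢
          rw [map_one]
          exact Ideal.mul_mem_left _ _ (Ideal.mem_sup_left h1)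
        | succ d =>
          have h1 : esymm (Fin (n + 1)) ℚ (d + 1) ∈ powEsymmIdeal (n + 1) k s :=
            esymm_mem_powEsymmIdeal (by omega)
          have h3 : X 0 ^ i * rename Fin.succ (esymm (Fin n) ℚ (d + 1)) =
              X 0 ^ i * esymm (Fin (n + 1)) ℚ (d + 1) -
                rename Fin.succ (esymm (Fin n) ℚ d) * X 0 ^ (i + 1) := by
            rw [esymm_fin_succ]; ring
          rw [h3]
          exact sub_mem (Ideal.mul_mem_left _ _ (Ideal.mem_sup_left h1))
            (Ideal.mul_mem_left _ _ (Ideal.mem_sup_right (Ideal.mem_span_singleton_self _)))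
      · split_ifs at hd with his
        · omega
        · have h1 := X_pow_mul_rename_esymm_mem (k := k) (s := s) s d hd hd
          have h2 : X 0 ^ i * rename Fin.succ (esymm (Fin n) ℚ d) =
              X 0 ^ (i - s) * (X 0 ^ s * rename Fin.succ (esymm (Fin n) ℚ d)) := by
            rw [← mul_assoc, ← pow_add, Nat.sub_add_cancel (by omega)]
          rw [h2]
          exact Ideal.mul_mem_left _ _ (Ideal.mem_sup_left h1)

/-- The number of functions from an `n`-element set to a `k`-element set whose image contains
a given `s`-element set (for `s ≤ k`). -/
def coveringCount (k : ℕ) : ℕ → ℕ → ℕ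
  | 0, s => if s = 0 then 1 else 0
  | n + 1, s => s * coveringCount k n (s - 1) + (k - s) * coveringCount k n s

theorem exists_finset_span_sup_powEsymmIdeal (k : ℕ) : ∀ n s, s ≤ k →
    ∃ B : Finset (MvPolynomial (Fin n) ℚ), B.card ≤ coveringCount k n s ∧
      Submodule.span ℚ (B : Set (MvPolynomial (Fin n) ℚ)) ⊔
        (powEsymmIdeal n k s).restrictScalars ℚ = ⊤ := by
  classical
  intro n
  induction n with
  | zero =>
    intro s _
    by_cases hs : s = 0
    · refine ⟨{1}, by simp [coveringCount, hs], ?_⟩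
      rw [eq_top_iff]
      intro p _
      obtain ⟨a, rfl⟩ := C_surjective (Fin 0) p
      refine Submodule.mem_sup_left ?_
      rw [Finset.coe_singleton, Submodule.mem_span_singleton]
      exact ⟨a, by rw [smul_eq_C_mul, mul_one]⟩
    · refine ⟨∅, by simp, ?_⟩
      have h1 : esymm (Fin 0) ℚ 0 ∈ powEsymmIdeal 0 k s := esymm_mem_powEsymmIdeal (by omega)
      rw [esymm_zero] at h1
      rw [(Ideal.eq_top_iff_one _).2 h1, Submodule.restrictScalars_top, sup_top_eq]
  | succ n ih =>
    intro s hsk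
    choose B hcard hspan using fun i : ℕ => ih (if i < s then s - 1 else s) (by split_ifs <;> omega)
    let B' := (Finset.range k).biUnion fun i => (B i).image fun b => X 0 ^ i * rename Fin.succ b
    refine ⟨B', ?_, ?_⟩
    · calc B'.card ≤ ∑ i ∈ Finset.range k, coveringCount k n (if i < s then s - 1 else s) :=
            Finset.card_biUnion_le.trans (Finset.sum_le_sum fun i _ =>
              Finset.card_image_le.trans (hcard i))
        _ = coveringCount k (n + 1) s := by
            obtain ⟨t, rfl⟩ := Nat.exists_eq_add_of_le hsk
            rw [Finset.sum_range_add,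
              Finset.sum_congr rfl (g := fun _ => coveringCount (s + t) n (s - 1))
              (fun i hi => by rw [if_pos (Finset.mem_range.1 hi)])]
            simp [coveringCount]
    · set M := Submodule.span ℚ (B' : Set (MvPolynomial (Fin (n + 1)) ℚ)) ⊔
        (powEsymmIdeal (n + 1) k s).restrictScalars ℚ with hM
      have key : ∀ j ≤ k, ∀ p, X 0 ^ (k - j) * p ∈ M := by
        intro j
        induction j with
        | zero =>
          intro _ p
          refine Submodule.mem_sup_right ?_
          exact Ideal.mul_mem_right _ _ (Ideal.subset_span (Or.inl ⟨0, rfl⟩))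
        | succ j ihj =>
          intro hj p
          have ihj := ihj (by omega)
          set i := k - (j + 1) with hi
          have hij : k - j = i + 1 := by omega
          rw [hij] at ihj
          obtain ⟨q, r, rfl⟩ := exists_rename_succ_add_X_mul p
          rw [mul_add, ← mul_assoc, ← pow_succ]
          refine add_mem ?_ (ihj r)
          have hq : q ∈ Submodule.span ℚ (B i : Set (MvPolynomial (Fin n) ℚ)) ⊔
            (powEsymmIdeal n k (if i < s then s - 1 else s)).restrictScalars ℚ := by
            rw [hspan]; trivial
          obtain ⟨b, hb, c, hc, rfl⟩ := Submodule.mem_sup.1 hq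
          rw [map_add, mul_add]
          refine add_mem ?_ ?_
          · refine Submodule.mem_sup_left ?_
            let φ : MvPolynomial (Fin n) ℚ →ₗ[ℚ] MvPolynomial (Fin (n + 1)) ℚ :=
              (LinearMap.mulLeft ℚ (X 0 ^ i)).comp (rename Fin.succ).toLinearMap
            have : φ b ∈ (Submodule.span ℚ (B i : Set (MvPolynomial (Fin n) ℚ))).map φ :=
              Submodule.mem_map_of_mem hb
            rw [Submodule.map_span] at this
            refine Submodule.span_mono ?_ this
            rintro _ ⟨x, hx, rfl⟩
            exact Finset.mem_coe.2 (Finset.mem_biUnion.2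
              ⟨i, Finset.mem_range.2 (by omega), Finset.mem_image_of_mem _ hx⟩)
          · obtain ⟨u, hu, v, hv, huv⟩ := Submodule.mem_sup.1 (X_pow_mul_rename_mem hc)
            rw [← huv]
            obtain ⟨w, rfl⟩ := Ideal.mem_span_singleton.1 hv
            exact add_mem (Submodule.mem_sup_right hu) (ihj w)
      rw [eq_top_iff]
      intro p _
      simpa using key k le_rfl p

theorem finite_and_finrank_quotient_le {n k s : ℕ} (hsk : s ≤ k) :
    Module.Finite ℚ (MvPolynomial (Fin n) ℚ ⧸ powEsymmIdeal n k s) ∧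
      Module.finrank ℚ (MvPolynomial (Fin n) ℚ ⧸ powEsymmIdeal n k s) ≤ coveringCount k n s := by
  classical
  obtain ⟨B, hcard, hB⟩ := exists_finset_span_sup_powEsymmIdeal k n s hsk
  let φ := (Ideal.Quotient.mkₐ ℚ (powEsymmIdeal n k s)).toLinearMap
  have htop : Submodule.span ℚ
      ((B.image φ : Finset _) : Set (MvPolynomial (Fin n) ℚ ⧸ powEsymmIdeal n k s)) = ⊤ := by
    rw [eq_top_iff]
    intro y _
    obtain ⟨p, rfl⟩ := Ideal.Quotient.mk_surjective y
    have hp : p ∈ Submodule.span ℚ (B : Set (MvPolynomial (Fin n) ℚ)) ⊔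
        (powEsymmIdeal n k s).restrictScalars ℚ := by rw [hB]; trivial
    obtain ⟨b, hb, c, hc, rfl⟩ := Submodule.mem_sup.1 hp
    rw [map_add, Ideal.Quotient.eq_zero_iff_mem.2 hc, add_zero, Finset.coe_image,
      ← Submodule.map_span]
    exact Submodule.mem_map_of_mem (f := φ) hb
  refine ⟨⟨B.image φ, htop⟩, ?_⟩
  rw [← finrank_top, ← htop]
  exact (finrank_span_finset_le_card _).trans (Finset.card_image_le.trans hcard)

theorem card_covering_eq_coveringCount {k : ℕ} (n : ℕ) : ∀ S : Finset (Fin k),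
    Nat.card {f : Fin n → Fin k // ∀ j ∈ S, ∃ i, f i = j} = coveringCount k n S.card := by
  induction n with
  | zero =>
    intro S
    by_cases hS : S = ∅
    · subst hS
      simp [coveringCount]
    · obtain ⟨j, hj⟩ := Finset.nonempty_iff_ne_empty.2 hS
      have : IsEmpty {f : Fin 0 → Fin k // ∀ j ∈ S, ∃ i, f i = j} :=
        ⟨fun f => (f.2 j hj).choose.elim0⟩
      rw [Nat.card_of_isEmpty]
      simp [coveringCount, hS]
  | succ n ih =>
    intro S
    let e : {f : Fin (n + 1) → Fin k // ∀ j ∈ S, ∃ i, f i = j} ≃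
        Σ a : Fin k, {f : Fin n → Fin k // ∀ j ∈ S.erase a, ∃ i, f i = j} :=
      { toFun := fun f => ⟨f.1 0, fun i => f.1 i.succ, fun j hj => by
          obtain ⟨i, hi⟩ := f.2 j (Finset.mem_of_mem_erase hj)
          induction i using Fin.cases with
          | zero => exact absurd hi.symm (Finset.ne_of_mem_erase hj)
          | succ i => exact ⟨i, hi⟩⟩
        invFun := fun g => ⟨Fin.cons g.1 g.2.1, fun j hj => by
          by_cases h : j = g.1
          · exact ⟨0, h.symm⟩
          · obtain ⟨i, hi⟩ := g.2.2 j (Finset.mem_erase.2 ⟨h, hj⟩)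
            exact ⟨i.succ, hi⟩⟩
        left_inv := fun f => Subtype.ext (Fin.cons_self_tail f.1)
        right_inv := fun g => rfl }
    rw [Nat.card_congr e, Nat.card_sigma]
    simp only [ih, Finset.card_erase_eq_ite, apply_ite (coveringCount k n)]
    rw [Finset.sum_ite]
    simp [coveringCount, Finset.filter_not, Finset.card_sdiff]

/-- The polynomials all of whose monomials have degree less than `d`. -/
noncomputable def degreeLTSubmodule (σ : Type*) (d : ℕ) : Submodule ℚ (MvPolynomial σ ℚ) :=
  restrictSupport ℚ {m | m.degree < d}

theorem mul_mem_degreeLTSubmodule {σ : Type*} {a b c : ℕ} {p q : MvPolynomial σ ℚ}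
    (hp : p ∈ degreeLTSubmodule σ a) (hq : q ∈ degreeLTSubmodule σ b) (h : a + b ≤ c + 1) :
    p * q ∈ degreeLTSubmodule σ c := by
  have h1 := Submodule.mul_mem_mul hp hq
  rw [degreeLTSubmodule, degreeLTSubmodule, ← restrictSupport_add] at h1
  refine restrictSupport_mono ℚ ?_ h1
  rintro _ ⟨m, hm, m', hm', rfl⟩
  have h2 : (m + m').degree = m.degree + m'.degree := map_add _ _ _
  change m.degree < a at hm
  change m'.degree < b at hm'
  change (m + m').degree < c
  omega

theorem degreeLTSubmodule_mono {σ : Type*} {a b : ℕ} (h : a ≤ b) :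
    degreeLTSubmodule σ a ≤ degreeLTSubmodule σ b :=
  restrictSupport_mono ℚ fun _ hm => lt_of_lt_of_le hm h

theorem mem_degreeLTSubmodule_of_isHomogeneous {σ : Type*} {e d : ℕ} {p : MvPolynomial σ ℚ}
    (hp : p.IsHomogeneous e) (h : e < d) : p ∈ degreeLTSubmodule σ d := by
  refine (mem_restrictSupport_iff ℚ).2 fun m hm => ?_
  have h1 : m.degree = e := by
    by_contra hne
    exact mem_support_iff.1 hm (hp.coeff_eq_zero hne)
  exact h1.trans_lt h

/-- Evaluation of polynomials on a family of points. -/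
noncomputable def evalPoints {σ Z : Type*} (v : Z → σ → ℚ) :
    MvPolynomial σ ℚ →ₗ[ℚ] (Z → ℚ) :=
  LinearMap.pi fun z => (aeval (v z)).toLinearMap

@[simp]
theorem evalPoints_apply {σ Z : Type*} (v : Z → σ → ℚ) (p : MvPolynomial σ ℚ) (z : Z) :
    evalPoints v p z = eval (v z) p := by
  simp [evalPoints, aeval_eq_eval]

theorem evalPoints_surjective {σ Z : Type*} [Finite Z] {v : Z → σ → ℚ}
    (hv : Function.Injective v) : Function.Surjective (evalPoints v) := by
  classical
  have := Fintype.ofFinite Z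
  have hsep : ∀ z w, ∃ p : MvPolynomial σ ℚ, w ≠ z → eval (v z) p = 1 ∧ eval (v w) p = 0 := by
    intro z w
    by_cases h : v z = v w
    · exact ⟨0, fun hw => absurd (hv h.symm) hw⟩
    · obtain ⟨i, hi⟩ := Function.ne_iff.1 h
      exact ⟨C (v z i - v w i)⁻¹ * (X i - C (v w i)), fun _ =>
        ⟨by simp [inv_mul_cancel₀ (sub_ne_zero.2 hi)], by simp⟩⟩
  choose p hp using hsep
  intro f
  refine ⟨∑ z, f z • ∏ w ∈ Finset.univ.erase z, p z w, ?_⟩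
  ext w
  rw [evalPoints_apply, map_sum, Finset.sum_eq_single w]
  · rw [smul_eval, eval_prod, Finset.prod_eq_one, mul_one]
    exact fun u hu => (hp w u (Finset.ne_of_mem_erase hu)).1
  · intro z _ hz
    rw [smul_eval, eval_prod, Finset.prod_eq_zero (Finset.mem_erase.2 ⟨hz.symm, Finset.mem_univ w⟩)
      (hp z w hz.symm).2, mul_zero]
  · simp

/-- `g` is the leading form, in degree `e`, of a polynomial vanishing at all points `v z`. -/
def IsLeadingForm {σ Z : Type*} (v : Z → σ → ℚ) (g : MvPolynomial σ ℚ) (e : ℕ) : Prop :=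
  g.IsHomogeneous e ∧ g ∈ LinearMap.ker (evalPoints v) ⊔ degreeLTSubmodule σ e

theorem IsLeadingForm.monomial_mul {σ Z : Type*} {v : Z → σ → ℚ} {g : MvPolynomial σ ℚ} {e : ℕ}
    (hg : IsLeadingForm v g e) (m : σ →₀ ℕ) :
    IsLeadingForm v (monomial m 1 * g) (m.degree + e) := by
  have hm : (monomial m (1 : ℚ)).IsHomogeneous m.degree := isHomogeneous_monomial _ rfl
  refine ⟨hm.mul hg.1, ?_⟩
  obtain ⟨G, hG, r, hr, hgr⟩ := Submodule.mem_sup.1 hg.2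
  rw [← hgr, mul_add]
  refine add_mem (Submodule.mem_sup_left ?_) (Submodule.mem_sup_right ?_)
  · rw [LinearMap.mem_ker] at hG ⊢
    ext z
    have := congrFun hG z
    rw [evalPoints_apply] at this ⊢
    rw [map_mul, this, Pi.zero_apply, mul_zero]
  · exact mul_mem_degreeLTSubmodule (mem_degreeLTSubmodule_of_isHomogeneous hm (Nat.lt_succ_self _))
      hr (by omega)

theorem homogeneousComponent_mem_of_leadingForms {σ Z : Type*} {v : Z → σ → ℚ}
    {S : Set (MvPolynomial σ ℚ)} (hS : ∀ g ∈ S, ∃ e, IsLeadingForm v g e)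
    {q : MvPolynomial σ ℚ} (hq : q ∈ Ideal.span S) (d : ℕ) :
    homogeneousComponent d q ∈ LinearMap.ker (evalPoints v) ⊔ degreeLTSubmodule σ d := by
  have htop : Submodule.span ℚ (Set.range fun m : σ →₀ ℕ => monomial m (1 : ℚ)) = ⊤ := by
    simpa using (basisMonomials σ ℚ).span_eq
  have hq' : q ∈ (Submodule.span (MvPolynomial σ ℚ) S).restrictScalars ℚ := hq
  rw [← Submodule.span_smul_of_span_eq_top htop] at hq'
  clear hq
  induction hq' using Submodule.span_induction with
  | zero => simp
  | add x y _ _ hx hy =>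
    rw [map_add]
    exact add_mem hx hy
  | smul a x _ hx =>
    rw [map_smul]
    exact Submodule.smul_mem _ _ hx
  | mem x hx =>
    obtain ⟨_, ⟨m, rfl⟩, g, hg, rfl⟩ := hx
    obtain ⟨e, he⟩ := hS g hg
    have h := he.monomial_mul m
    change homogeneousComponent d (monomial m 1 * g) ∈ _
    rw [homogeneousComponent_of_mem h.1]
    split_ifs with hd
    · rw [hd]; exact h.2
    · exact zero_mem _

/-- If an ideal is generated by leading forms of polynomials that vanish on a finite set of points,
then its quotient has dimension at least the number of points. -/
theorem card_le_finrank_quotient_of_leadingForms {σ Z : Type*} [Finite Z] {v : Z → σ → ℚ}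
    (hv : Function.Injective v) {S : Set (MvPolynomial σ ℚ)}
    (hS : ∀ g ∈ S, ∃ e, IsLeadingForm v g e)
    [Module.Finite ℚ (MvPolynomial σ ℚ ⧸ Ideal.span S)] :
    Nat.card Z ≤ Module.finrank ℚ (MvPolynomial σ ℚ ⧸ Ideal.span S) := by
  have := Fintype.ofFinite Z
  let π := (Ideal.Quotient.mkₐ ℚ (Ideal.span S)).toLinearMap
  have htop : Submodule.span ℚ (Set.range fun m : σ →₀ ℕ => monomial m (1 : ℚ)) = ⊤ := by
    simpa using (basisMonomials σ ℚ).span_eq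
  obtain ⟨κ, a, -, hsp, hli⟩ := exists_linearIndependent' ℚ fun m : σ →₀ ℕ => π (monomial m 1)
  have hπ : Submodule.span ℚ (Set.range fun m : σ →₀ ℕ => π (monomial m 1)) = ⊤ := by
    have h1 : (Set.range fun m : σ →₀ ℕ => π (monomial m 1)) =
      π '' Set.range fun m : σ →₀ ℕ => monomial m (1 : ℚ) := by rw [← Set.range_comp]; rfl
    rw [h1, ← Submodule.map_span, htop, Submodule.map_top]
    exact LinearMap.range_eq_top.2 Ideal.Quotient.mk_surjective
  rw [hπ] at hsp
  have := hli.finite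
  have := Fintype.ofFinite κ
  rw [Module.finrank_eq_card_basis (Module.Basis.mk hli hsp.ge)]
  set W := Submodule.span ℚ (Set.range fun j => monomial (a j) (1 : ℚ)) with hW
  have hWcomp : ∀ d, ∀ p ∈ W, homogeneousComponent d p ∈ W := by
    intro d p hp
    have h1 := Submodule.mem_map_of_mem (f := homogeneousComponent d) hp
    rw [hW, Submodule.map_span] at h1
    refine Submodule.span_le.2 ?_ h1
    rintro _ ⟨_, ⟨j, rfl⟩, rfl⟩
    change homogeneousComponent d (monomial (a j) 1) ∈ W
    rw [homogeneousComponent_of_mem (isHomogeneous_monomial (1 : ℚ) rfl)]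
    split_ifs
    · exact Submodule.subset_span ⟨j, rfl⟩
    · exact zero_mem _
  have hmon : ∀ d, ∀ m : σ →₀ ℕ, m.degree = d →
      monomial m (1 : ℚ) ∈ W ⊔ LinearMap.ker (evalPoints v) := by
    intro d
    induction d using Nat.strong_induction_on with
    | _ d ih =>
      intro m hm
      have h1 : π (monomial m 1) ∈ W.map π := by
        rw [hW, Submodule.map_span, ← Set.range_comp]
        exact hsp.ge trivial
      obtain ⟨w, hw, hwm⟩ := h1
      have h2 : monomial m 1 - w ∈ Ideal.span S := Ideal.Quotient.eq.1 hwm.symm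
      have h3 := homogeneousComponent_mem_of_leadingForms hS h2 d
      rw [map_sub, homogeneousComponent_eq_self (isHomogeneous_monomial (1 : ℚ) hm)] at h3
      have h4 : degreeLTSubmodule σ d ≤ W ⊔ LinearMap.ker (evalPoints v) := by
        rw [degreeLTSubmodule, restrictSupport_eq_span, Submodule.span_le]
        rintro _ ⟨m', hm', rfl⟩
        exact ih _ hm' m' rfl
      have h5 := sup_le le_sup_right h4 h3
      simpa using add_mem h5 (Submodule.mem_sup_left (hWcomp d w hw))
  have hWtop : W ⊔ LinearMap.ker (evalPoints v) = ⊤ := by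
    rw [eq_top_iff, ← htop, Submodule.span_le]
    rintro _ ⟨m, rfl⟩
    exact hmon _ m rfl
  have hmap : W.map (evalPoints v) = ⊤ := by
    have h1 := LinearMap.range_eq_top.2 (evalPoints_surjective hv)
    rw [LinearMap.range_eq_map, ← hWtop, Submodule.map_sup] at h1
    rwa [LinearMap.le_ker_iff_map.1 le_rfl, sup_bot_eq] at h1
  rw [hW, Submodule.map_span, ← Set.range_comp] at hmap
  have h1 := finrank_range_le_card (R := ℚ) ((evalPoints v) ∘ fun j => monomial (a j) (1 : ℚ))
  rw [Set.finrank, hmap, finrank_top, Module.finrank_fintype_fun_eq_card] at h1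
  rwa [Nat.card_eq_fintype_card]

theorem isLeadingForm_X_pow {σ Z : Type*} {v : Z → σ → ℚ} {k : ℕ} {i : σ}
    (h : ∀ z, ∃ j < k, v z i = (j : ℚ)) : IsLeadingForm v (X i ^ k) k := by
  refine ⟨by simpa using (isHomogeneous_X ℚ i).pow k, ?_⟩
  have hlow : ∀ m : ℕ, X i ^ m - ∏ j ∈ Finset.range m, (X i - C (j : ℚ)) ∈
      degreeLTSubmodule σ m := by
    intro m
    induction m with
    | zero => simp
    | succ m ih =>
      set Q : MvPolynomial σ ℚ := ∏ j ∈ Finset.range m, (X i - C (j : ℚ)) with hQ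
      have h1 : X i ^ m ∈ degreeLTSubmodule σ (m + 1) :=
        mem_degreeLTSubmodule_of_isHomogeneous (by simpa using (isHomogeneous_X ℚ i).pow m)
          (Nat.lt_succ_self m)
      have h2 : Q ∈ degreeLTSubmodule σ (m + 1) := by
        have := sub_mem h1 (degreeLTSubmodule_mono (Nat.le_succ m) ih)
        simpa using this
      have h3 : X i ^ (m + 1) - ∏ j ∈ Finset.range (m + 1), (X i - C (j : ℚ)) =
          X i * (X i ^ m - Q) + (m : ℚ) • Q := by
        rw [Finset.prod_range_succ, ← hQ, smul_eq_C_mul]; ring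
      rw [h3]
      exact add_mem (mul_mem_degreeLTSubmodule (mem_degreeLTSubmodule_of_isHomogeneous
        (isHomogeneous_X ℚ i) one_lt_two) ih (by omega)) (Submodule.smul_mem _ _ h2)
  refine Submodule.mem_sup.2 ⟨∏ j ∈ Finset.range k, (X i - C (j : ℚ)), ?_, _, hlow k,
    add_sub_cancel _ _⟩
  rw [LinearMap.mem_ker]
  ext z
  obtain ⟨j, hj, hz⟩ := h z
  rw [evalPoints_apply, eval_prod, Finset.prod_eq_zero (Finset.mem_range.2 hj) (by simp [hz])]
  rfl

theorem coeff_prod_one_add_C_mul_X {ι R : Type*} [CommRing R] (T : Finset ι) (a : ι → R) (d : ℕ) :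
    PowerSeries.coeff d (∏ i ∈ T, (1 + PowerSeries.C (a i) * PowerSeries.X)) =
      ∑ t ∈ T.powersetCard d, ∏ i ∈ t, a i := by
  have h : ∀ t : Finset ι, PowerSeries.coeff d
      (∏ i ∈ t, (PowerSeries.C (a i) * PowerSeries.X)) = if t.card = d then ∏ i ∈ t, a i else 0 := by
    intro t
    rw [Finset.prod_mul_distrib, Finset.prod_const, ← map_prod, PowerSeries.coeff_C_mul,
      PowerSeries.coeff_X_pow]
    simp [eq_comm]
  rw [Finset.prod_one_add, map_sum, Finset.sum_congr rfl fun t _ => h t, ← Finset.sum_filter,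
    Finset.powersetCard_eq_filter]

theorem esymm_isHomogeneous {σ : Type*} [Fintype σ] (d : ℕ) :
    (esymm σ ℚ d).IsHomogeneous d := by
  refine IsHomogeneous.sum _ _ _ fun t ht => ?_
  have h := IsHomogeneous.prod t (fun i : σ => (X i : MvPolynomial σ ℚ)) (fun _ => 1)
    fun i _ => isHomogeneous_X ℚ i
  simpa [(Finset.mem_powersetCard.1 ht).2] using h

theorem isLeadingForm_esymm {σ Z ι : Type*} [Fintype σ] [Fintype ι] {v : Z → σ → ℚ} {d : ℕ}
    (α : ι → ℚ) (h : ∀ z, ∃ c : ι → σ, Function.Injective c ∧ ∀ j, v z (c j) = α j)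
    (hd : Fintype.card σ < d + Fintype.card ι) : IsLeadingForm v (esymm σ ℚ d) d := by
  classical
  refine ⟨esymm_isHomogeneous d, ?_⟩
  set A : PowerSeries ℚ := ∏ j, (1 + PowerSeries.C (α j) * PowerSeries.X) with hA
  have hA0 : PowerSeries.constantCoeff A = 1 := by simp [hA]
  set G : MvPolynomial σ ℚ := ∑ p ∈ Finset.HasAntidiagonal.antidiagonal d,
    PowerSeries.coeff p.1 A⁻¹ • esymm σ ℚ p.2 with hG
  have hker : G ∈ LinearMap.ker (evalPoints v) := by
    rw [LinearMap.mem_ker]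
    ext z
    obtain ⟨c, hc, hcz⟩ := h z
    have hE : ∀ b, eval (v z) (esymm σ ℚ b) =
        PowerSeries.coeff b (∏ i, (1 + PowerSeries.C (v z i) * PowerSeries.X)) := by
      intro b
      rw [coeff_prod_one_add_C_mul_X, esymm, map_sum]
      simp
    have hsplit : ∏ i, (1 + PowerSeries.C (v z i) * PowerSeries.X) = A *
        ∏ i ∈ (Finset.univ.image c)ᶜ, (1 + PowerSeries.C (v z i) * PowerSeries.X) := by
      rw [← Finset.prod_mul_prod_compl (Finset.univ.image c), Finset.prod_image hc.injOn]
      simp only [hcz, hA]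
    have hev : evalPoints v G z = PowerSeries.coeff d
        (A⁻¹ * ∏ i, (1 + PowerSeries.C (v z i) * PowerSeries.X)) := by
      rw [evalPoints_apply, PowerSeries.coeff_mul, hG, map_sum]
      simp only [smul_eval, hE]
    rw [hev, hsplit, ← mul_assoc, PowerSeries.inv_mul_cancel _ (by rw [hA0]; exact one_ne_zero),
      one_mul, coeff_prod_one_add_C_mul_X, Finset.powersetCard_eq_empty.2, Finset.sum_empty]
    · rfl
    · rw [Finset.card_compl, Finset.card_image_of_injective _ hc, Finset.card_univ]
      have := Fintype.card_le_of_injective c hc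
      omega
  refine Submodule.mem_sup.2 ⟨G, hker, esymm σ ℚ d - G, ?_, add_sub_cancel _ _⟩
  have h0 : PowerSeries.coeff 0 A⁻¹ = 1 := by
    rw [PowerSeries.coeff_zero_eq_constantCoeff_apply, PowerSeries.constantCoeff_inv, hA0, inv_one]
  have hmem : (0, d) ∈ Finset.HasAntidiagonal.antidiagonal d :=
    Finset.HasAntidiagonal.mem_antidiagonal.2 (zero_add d)
  rw [hG, ← Finset.add_sum_erase _ _ hmem, h0, one_smul,
    sub_add_cancel_left]
  refine neg_mem (sum_mem fun p hp => Submodule.smul_mem _ _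
    (mem_degreeLTSubmodule_of_isHomogeneous (esymm_isHomogeneous _) ?_))
  obtain ⟨hp1, hp2⟩ := Finset.mem_erase.1 hp
  rw [Finset.HasAntidiagonal.mem_antidiagonal] at hp2
  by_contra hlt
  exact hp1 (Prod.ext (by simp; omega) (by simp; omega))

theorem stmt16 (n k s : ℕ) (hs : 1 ≤ s) (hsk : s ≤ k) (hkn : k ≤ n) :
    FiniteDimensional ℚ (MvPolynomial (Fin n) ℚ ⧸ Inks n k s) ∧
    Module.finrank ℚ (MvPolynomial (Fin n) ℚ ⧸ Inks n k s)
      = Nat.card {f : Fin n → Fin k // ∀ j : Fin k, (j : ℕ) < s → ∃ i : Fin n, f i = j} := by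
  rw [Inks_eq_powEsymmIdeal (hsk.trans hkn)]
  obtain ⟨hfin, hle⟩ := finite_and_finrank_quotient_le (n := n) hsk
  refine ⟨hfin, le_antisymm ?_ ?_⟩
  · have h1 := card_covering_eq_coveringCount n (Finset.univ.filter fun j : Fin k => (j : ℕ) < s)
    have h2 : (Finset.univ.filter fun j : Fin k => (j : ℕ) < s).card = s := by
      rw [Fin.card_filter_val_lt, min_eq_right hsk]
    rw [h2] at h1
    simp only [Finset.mem_filter, Finset.mem_univ, true_and] at h1
    rwa [h1]
  · let v : {f : Fin n → Fin k // ∀ j : Fin k, (j : ℕ) < s → ∃ i : Fin n, f i = j} → Fin n → ℚ :=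
      fun f i => ((f.1 i : ℕ) : ℚ)
    have hv : Function.Injective v := fun f g hfg => Subtype.ext <| funext fun i =>
      Fin.ext (Nat.cast_injective (R := ℚ) (congrFun hfg i))
    unfold powEsymmIdeal at hfin ⊢
    refine card_le_finrank_quotient_of_leadingForms hv ?_
    rintro g (⟨i, rfl⟩ | ⟨d, hd, rfl⟩)
    · exact ⟨k, isLeadingForm_X_pow fun f => ⟨f.1 i, (f.1 i).2, rfl⟩⟩
    · refine ⟨d, isLeadingForm_esymm (fun j : Fin s => ((j : ℕ) : ℚ)) (fun f => ?_) (by simpa)⟩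
      choose c hc using fun j : Fin s => f.2 ⟨j, j.2.trans_le hsk⟩ j.2
      refine ⟨c, fun a b hab => Fin.ext ?_, fun j => by simp [v, hc]⟩
      have := (hc a).symm.trans ((congrArg f.1 hab).trans (hc b))
      simpa using this
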